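/- Let n ≥ 1. The number of permutations π in S_n avoiding 321 as a consecutive pattern with ilpk(π) = 1 equals Σ_{i=1}^{n-1} Σ_{j=1}^{i} f_{j-1} f_j = f_{n-1} f_n − ⌊(n+1)/2⌋, where f_k denotes the Fibonacci numbers with f_0 = f_1 = 1. -/

import Mathlib

open Finset

/-- The 1-based word of values of a permutation `π ∈ S_n`: `val π i` is the value
(in `{1, …, n}`) of `π` at the 1-based position `i`, and `0` if `i` is out of range. -/
def pval {n : ℕ} (π : Equiv.Perm (Fin n)) (i : ℕ) : ℕ :=
  if h : 1 ≤ i ∧ i - 1 < n then (π ⟨i - 1, h.2⟩ : ℕ) + 1 else 0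

/-- The descent set of `π ∈ S_n`: the set of `i ∈ [n-1]` with `π_i > π_{i+1}`. -/
def desSet {n : ℕ} (π : Equiv.Perm (Fin n)) : Finset ℕ :=
  (Finset.Icc 1 (n - 1)).filter (fun i => pval π (i + 1) < pval π i)

/-- The descent number. -/
def des {n : ℕ} (π : Equiv.Perm (Fin n)) : ℕ := (desSet π).card

/-- The major index: the sum of the descents. -/
def maj {n : ℕ} (π : Equiv.Perm (Fin n)) : ℕ := ∑ i ∈ desSet π, i

/-- The comajor index: `comaj π = ∑_{i ∈ Des π} (n - i)`. -/
def comaj {n : ℕ} (π : Equiv.Perm (Fin n)) : ℕ := ∑ i ∈ desSet π, (n - i)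

/-- The peak number: the number of `i` with `2 ≤ i ≤ n-1` and `π_{i-1} < π_i > π_{i+1}`. -/
def pk {n : ℕ} (π : Equiv.Perm (Fin n)) : ℕ :=
  ((Finset.Icc 2 (n - 1)).filter
    (fun i => pval π (i - 1) < pval π i ∧ pval π (i + 1) < pval π i)).card

/-- The left peak number: the number of `i ∈ [n-1]` which are peaks of `π`, or `i = 1`
when `1` is a descent (equivalently, peaks of `0π`; note `pval π 0 = 0`). -/
def lpk {n : ℕ} (π : Equiv.Perm (Fin n)) : ℕ :=
  ((Finset.Icc 1 (n - 1)).filter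
    (fun i => pval π (i - 1) < pval π i ∧ pval π (i + 1) < pval π i)).card

/-- Inverse descent number. -/
def ides {n : ℕ} (π : Equiv.Perm (Fin n)) : ℕ := des π⁻¹

/-- Inverse major index. -/
def imaj {n : ℕ} (π : Equiv.Perm (Fin n)) : ℕ := maj π⁻¹

/-- Inverse comajor index. -/
def icomaj {n : ℕ} (π : Equiv.Perm (Fin n)) : ℕ := comaj π⁻¹

/-- Inverse peak number. -/
def ipk {n : ℕ} (π : Equiv.Perm (Fin n)) : ℕ := pk π⁻¹

/-- Inverse left peak number. -/
def ilpk {n : ℕ} (π : Equiv.Perm (Fin n)) : ℕ := lpk π⁻¹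

/-- The reverse `π^r` of `π`, with `(π^r)_i = π_{n+1-i}`. -/
def prev {n : ℕ} (π : Equiv.Perm (Fin n)) : Equiv.Perm (Fin n) :=
  (Fin.revPerm : Equiv.Perm (Fin n)).trans π

/-- The complement `π^c` of `π`, with `(π^c)_i = n + 1 - π_i`. -/
def pcomp {n : ℕ} (π : Equiv.Perm (Fin n)) : Equiv.Perm (Fin n) :=
  π.trans (Fin.revPerm : Equiv.Perm (Fin n))

/-- The reverse-complement `π^{rc} = (π^r)^c` of `π`. -/
def prc {n : ℕ} (π : Equiv.Perm (Fin n)) : Equiv.Perm (Fin n) := pcomp (prev π)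


/-- `π ∈ S_n` avoids `321` as a consecutive pattern: there is no (1-based) index `i`
with `π_i > π_{i+1} > π_{i+2}`. -/
def Avoids321 {n : ℕ} (π : Equiv.Perm (Fin n)) : Prop :=
  ∀ i : ℕ, 1 ≤ i → i + 2 ≤ n →
    ¬ (pval π (i + 1) < pval π i ∧ pval π (i + 2) < pval π (i + 1))

/-- The Fibonacci numbers with `f 0 = f 1 = 1` and `f n = f (n-1) + f (n-2)`. -/
def fib1 (k : ℕ) : ℕ := Nat.fib (k + 1)

/-! ### Words over three letters -/

/-- A permutation whose inverse has a single left peak splits its values into a low increasing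
run, a middle decreasing run and a high increasing run; the letters record the run. -/
inductive Letter
  | low
  | mid
  | high
  deriving DecidableEq

instance : Fintype Letter := ⟨{.low, .mid, .high}, fun a => by cases a <;> decide⟩

/-- The word obtained from `w` by prepending the letter `a`. -/
def wcons (a : Letter) (w : ℕ → Letter) : ℕ → Letter
  | 0 => a
  | i + 1 => w i

@[simp] lemma wcons_zero (a : Letter) (w : ℕ → Letter) : wcons a w 0 = a := rfl

@[simp] lemma wcons_succ (a : Letter) (w : ℕ → Letter) (i : ℕ) : wcons a w (i + 1) = w i := rfl

/-- Words of length `n`, padded with the letter `high`. -/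
def Padded (n : ℕ) (w : ℕ → Letter) : Prop := ∀ i, n ≤ i → w i = .high

/-- No letter `mid` is preceded by `mid` or `high` and followed by `low` or `mid`. -/
def NoDoubleDescent (w : ℕ → Letter) : Prop :=
  ∀ i, w i ≠ .low → w (i + 1) = .mid → w (i + 2) = .high

/-- Every `low` is followed, somewhere, by a `mid`. -/
def LowBeforeMid (w : ℕ → Letter) : Prop := ∀ i, w i = .low → ∃ j, i < j ∧ w j = .mid

/-- A word which contains `mid` and whose last letter other than `high` is `mid`. -/
def EndsMid (w : ℕ → Letter) : Prop := (∃ i, w i = .mid) ∧ LowBeforeMid w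

/-- The words that encode permutations avoiding `321` with one inverse left peak. -/
structure GoodWord (w : ℕ → Letter) : Prop where
  noDoubleDescent : NoDoubleDescent w
  lowBeforeMid : LowBeforeMid w
  midBeforeHigh : ∀ j, w j = .high → ∃ i, i < j ∧ w i = .mid
  twoMids : ∃ i j, i < j ∧ w i = .mid ∧ w j = .mid

/-- The number of words of length `n` with the property `P`. -/
noncomputable def wordCount (n : ℕ) (P : (ℕ → Letter) → Prop) : ℕ :=
  Nat.card {w : ℕ → Letter // Padded n w ∧ P w}

lemma finite_padded (n : ℕ) (P : (ℕ → Letter) → Prop) :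
    Finite {w : ℕ → Letter // Padded n w ∧ P w} := by
  refine Finite.of_injective (β := Fin n → Letter) (fun w i => w.1 i) ?_
  intro w w' h
  ext i
  by_cases hi : i < n
  · exact congrFun h ⟨i, hi⟩
  · rw [w.2.1 i (by omega), w'.2.1 i (by omega)]

lemma wcons_shift (w : ℕ → Letter) : wcons (w 0) (fun i => w (i + 1)) = w := by
  funext i
  cases i <;> rfl

lemma padded_succ_wcons {n : ℕ} {a : Letter} {w : ℕ → Letter} :
    Padded (n + 1) (wcons a w) ↔ Padded n w := by
  constructor
  · intro h i hi
    exact h (i + 1) (by omega)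
  · intro h i hi
    obtain ⟨i, rfl⟩ : ∃ k, i = k + 1 := ⟨i - 1, by omega⟩
    exact h i (by omega)

/-- Splitting a word into its first letter and the remaining word. -/
def paddedSuccEquiv (n : ℕ) (P : (ℕ → Letter) → Prop) :
    {w : ℕ → Letter // Padded (n + 1) w ∧ P w} ≃
      Σ a : Letter, {w : ℕ → Letter // Padded n w ∧ P (wcons a w)} where
  toFun w := ⟨w.1 0, fun i => w.1 (i + 1), by
    refine ⟨padded_succ_wcons (a := w.1 0).1 ?_, ?_⟩
    · rw [wcons_shift]; exact w.2.1
    · rw [wcons_shift]; exact w.2.2⟩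
  invFun w := ⟨wcons w.1 w.2.1, padded_succ_wcons.2 w.2.2.1, w.2.2.2⟩
  left_inv w := Subtype.ext (wcons_shift w.1)
  right_inv _ := rfl

lemma wordCount_succ (n : ℕ) (P : (ℕ → Letter) → Prop) :
    wordCount (n + 1) P = wordCount n (fun w => P (wcons .low w)) +
      wordCount n (fun w => P (wcons .mid w)) + wordCount n (fun w => P (wcons .high w)) := by
  have := fun a => finite_padded n (fun w => P (wcons a w))
  have huniv : (Finset.univ : Finset Letter) = {.low, .mid, .high} := rfl
  unfold wordCount
  rw [Nat.card_congr (paddedSuccEquiv n P), Nat.card_sigma, huniv,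
    Finset.sum_insert (by decide), Finset.sum_insert (by decide), Finset.sum_singleton, add_assoc]

lemma wordCount_congr {n : ℕ} {P Q : (ℕ → Letter) → Prop} (h : ∀ w, P w ↔ Q w) :
    wordCount n P = wordCount n Q := by
  rw [funext fun w => propext (h w)]

lemma wordCount_eq_zero {n : ℕ} {P : (ℕ → Letter) → Prop} (h : ∀ w, Padded n w → ¬ P w) :
    wordCount n P = 0 := by
  have : IsEmpty {w : ℕ → Letter // Padded n w ∧ P w} := ⟨fun w => h w.1 w.2.1 w.2.2⟩
  exact Nat.card_of_isEmpty

lemma wordCount_or_allHigh {n : ℕ} {P : (ℕ → Letter) → Prop} (h : ¬ P fun _ => .high) :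
    wordCount n (fun w => P w ∨ ∀ i, w i = .high) = wordCount n P + 1 := by
  have hfin := finite_padded n P
  have hset : {w : ℕ → Letter | Padded n w ∧ (P w ∨ ∀ i, w i = .high)} =
      insert (fun _ => .high) {w | Padded n w ∧ P w} := by
    ext w
    simp only [Set.mem_insert_iff, Set.mem_ofPred_eq, funext_iff, Padded]
    grind
  have hcard := Set.ncard_insert_of_notMem (a := fun _ => Letter.high)
    (s := {w | Padded n w ∧ P w}) (fun hw => h hw.2) hfin
  rw [← hset] at hcard
  exact hcard

lemma noDoubleDescent_of_allHigh {w : ℕ → Letter} (h : ∀ i, w i = .high) :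
    NoDoubleDescent w := fun i _ _ => h (i + 2)

lemma noDoubleDescent_wcons {a : Letter} {w : ℕ → Letter} :
    NoDoubleDescent (wcons a w) ↔
      NoDoubleDescent w ∧ (a ≠ .low → w 0 = .mid → w 1 = .high) := by
  constructor
  · exact fun h => ⟨fun i => h (i + 1), h 0⟩
  · rintro ⟨h, h0⟩ (_ | i)
    · exact h0
    · exact h i

lemma exists_mid_wcons {a : Letter} {w : ℕ → Letter} :
    (∃ i, wcons a w i = .mid) ↔ a = .mid ∨ ∃ i, w i = .mid := by
  rw [← Nat.or_exists_add_one]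
  simp

lemma lowBeforeMid_wcons {a : Letter} {w : ℕ → Letter} :
    LowBeforeMid (wcons a w) ↔ LowBeforeMid w ∧ (a = .low → ∃ i, w i = .mid) := by
  constructor
  · intro h
    constructor
    · intro i hi
      obtain ⟨_ | j, hj, hm⟩ := h (i + 1) hi
      · omega
      · exact ⟨j, by omega, hm⟩
    · intro ha
      obtain ⟨_ | j, hj, hm⟩ := h 0 ha
      · omega
      · exact ⟨j, hm⟩
  · rintro ⟨h, h0⟩ (_ | i) hi
    · obtain ⟨j, hj⟩ := h0 hi
      exact ⟨j + 1, by omega, hj⟩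
    · obtain ⟨j, hj, hm⟩ := h i hi
      exact ⟨j + 1, by omega, hm⟩

lemma endsMid_low {w : ℕ → Letter} : EndsMid (wcons .low w) ↔ EndsMid w := by
  simp only [EndsMid, exists_mid_wcons, lowBeforeMid_wcons]
  grind

lemma endsMid_high {w : ℕ → Letter} : EndsMid (wcons .high w) ↔ EndsMid w := by
  simp only [EndsMid, exists_mid_wcons, lowBeforeMid_wcons]
  grind

lemma endsMid_mid {w : ℕ → Letter} :
    EndsMid (wcons .mid w) ↔ EndsMid w ∨ ∀ i, w i = .high := by
  simp only [EndsMid, exists_mid_wcons, lowBeforeMid_wcons]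
  simp only [LowBeforeMid]
  constructor
  · rintro ⟨-, h, -⟩
    by_cases hm : ∃ i, w i = .mid
    · exact Or.inl ⟨hm, h⟩
    · refine Or.inr fun i => ?_
      cases hi : w i with
      | low => exact (hm ((h i hi).imp fun _ => And.right)).elim
      | mid => exact (hm ⟨i, hi⟩).elim
      | high => rfl
  · grind

/-- Number of continuations of a word ending in `low`. -/
noncomputable def countAfterLow (n : ℕ) : ℕ :=
  wordCount n fun w => EndsMid w ∧ NoDoubleDescent w

/-- Number of continuations of a word ending in `high`, or consisting of a first `mid`. -/
noncomputable def countAfterHigh (n : ℕ) : ℕ :=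
  wordCount n fun w => EndsMid w ∧ NoDoubleDescent w ∧ (w 0 = .mid → w 1 = .high)

/-- Number of continuations of a word whose last letter `mid` is a descent bottom. -/
noncomputable def countAfterBottom (n : ℕ) : ℕ :=
  wordCount n fun w => EndsMid w ∧ NoDoubleDescent w ∧ w 0 = .high

lemma countAfterLow_succ (n : ℕ) :
    countAfterLow (n + 1) = countAfterLow n + 2 * countAfterHigh n + 1 := by
  have hmid : wordCount n (fun w => EndsMid (wcons .mid w) ∧ NoDoubleDescent (wcons .mid w)) =
      countAfterHigh n + 1 := by
    rw [countAfterHigh, ← wordCount_or_allHigh (by simp [EndsMid])]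
    refine wordCount_congr fun w => ?_
    simp only [endsMid_mid, noDoubleDescent_wcons]
    have := noDoubleDescent_of_allHigh (w := w)
    grind
  have hlow : wordCount n (fun w => EndsMid (wcons .low w) ∧ NoDoubleDescent (wcons .low w)) =
      countAfterLow n :=
    wordCount_congr fun w => by simp [endsMid_low, noDoubleDescent_wcons]
  have hhigh : wordCount n
      (fun w => EndsMid (wcons .high w) ∧ NoDoubleDescent (wcons .high w)) = countAfterHigh n :=
    wordCount_congr fun w => by simp [endsMid_high, noDoubleDescent_wcons]
  rw [countAfterLow, wordCount_succ, hmid, hlow, hhigh]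
  ring

lemma countAfterHigh_succ (n : ℕ) :
    countAfterHigh (n + 1) = countAfterLow n + countAfterBottom n + countAfterHigh n + 1 := by
  rw [countAfterHigh, wordCount_succ]
  have hmid : wordCount n (fun w => EndsMid (wcons .mid w) ∧ NoDoubleDescent (wcons .mid w) ∧
      (wcons .mid w 0 = .mid → wcons .mid w 1 = .high)) = countAfterBottom n + 1 := by
    rw [countAfterBottom, ← wordCount_or_allHigh (by simp [EndsMid])]
    refine wordCount_congr fun w => ?_
    simp only [endsMid_mid, noDoubleDescent_wcons, wcons_zero,
      show wcons .mid w 1 = w 0 from rfl]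
    have := noDoubleDescent_of_allHigh (w := w)
    grind
  have hlow : wordCount n (fun w => EndsMid (wcons .low w) ∧ NoDoubleDescent (wcons .low w) ∧
      (wcons .low w 0 = .mid → wcons .low w 1 = .high)) = countAfterLow n :=
    wordCount_congr fun w => by simp [endsMid_low, noDoubleDescent_wcons]
  have hhigh : wordCount n (fun w => EndsMid (wcons .high w) ∧
      NoDoubleDescent (wcons .high w) ∧
      (wcons .high w 0 = .mid → wcons .high w 1 = .high)) = countAfterHigh n :=
    wordCount_congr fun w => by simp [endsMid_high, noDoubleDescent_wcons]
  rw [hmid, hlow, hhigh]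
  ring

lemma countAfterBottom_succ (n : ℕ) : countAfterBottom (n + 1) = countAfterHigh n := by
  rw [countAfterBottom, wordCount_succ, wordCount_eq_zero (by simp),
    wordCount_eq_zero (by simp), countAfterHigh, zero_add, zero_add]
  exact wordCount_congr fun w => by simp [endsMid_high, noDoubleDescent_wcons]

lemma not_endsMid_of_padded_zero {w : ℕ → Letter} (hw : Padded 0 w) : ¬ EndsMid w := by
  rintro ⟨⟨i, hi⟩, -⟩
  simp [hw i (Nat.zero_le i)] at hi

lemma goodWord_low {w : ℕ → Letter} : GoodWord (wcons .low w) ↔ GoodWord w := by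
  constructor
  · rintro ⟨h1, h2, h3, i, j, hij, hi, hj⟩
    refine ⟨(noDoubleDescent_wcons.1 h1).1, (lowBeforeMid_wcons.1 h2).1, fun j hj => ?_, ?_⟩
    · obtain ⟨_ | i, hi, hm⟩ := h3 (j + 1) hj
      · simp at hm
      · exact ⟨i, by omega, hm⟩
    · rcases i with _ | i
      · simp at hi
      rcases j with _ | j
      · simp at hj
      exact ⟨i, j, by omega, hi, hj⟩
  · rintro ⟨h1, h2, h3, i, j, hij, hi, hj⟩
    refine ⟨noDoubleDescent_wcons.2 ⟨h1, by simp⟩,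
      lowBeforeMid_wcons.2 ⟨h2, fun _ => ⟨i, hi⟩⟩, ?_, i + 1, j + 1, by omega, hi, hj⟩
    rintro (_ | k) hk
    · simp at hk
    · obtain ⟨l, hl, hm⟩ := h3 k hk
      exact ⟨l + 1, by omega, hm⟩

lemma goodWord_mid {w : ℕ → Letter} : GoodWord (wcons .mid w) ↔
    EndsMid w ∧ NoDoubleDescent w ∧ (w 0 = .mid → w 1 = .high) := by
  constructor
  · rintro ⟨h1, h2, -, i, j, hij, -, hj⟩
    obtain ⟨h1, h1'⟩ := noDoubleDescent_wcons.1 h1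
    obtain ⟨j, rfl⟩ : ∃ k, j = k + 1 := ⟨j - 1, by omega⟩
    exact ⟨⟨⟨j, hj⟩, (lowBeforeMid_wcons.1 h2).1⟩, h1, h1' (by simp)⟩
  · rintro ⟨⟨⟨j, hj⟩, h2⟩, h1, h1'⟩
    refine ⟨noDoubleDescent_wcons.2 ⟨h1, fun _ => h1'⟩,
      lowBeforeMid_wcons.2 ⟨h2, by simp⟩, ?_, 0, j + 1, by omega, rfl, hj⟩
    rintro (_ | k) hk
    · simp at hk
    · exact ⟨0, by omega, rfl⟩

lemma not_goodWord_high {w : ℕ → Letter} : ¬ GoodWord (wcons .high w) := by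
  intro h
  obtain ⟨i, hi, -⟩ := h.midBeforeHigh 0 rfl
  omega

lemma wordCount_goodWord_succ (n : ℕ) :
    wordCount (n + 1) GoodWord = wordCount n GoodWord + countAfterHigh n := by
  rw [wordCount_succ, wordCount_congr fun _ => goodWord_low,
    wordCount_congr fun _ => goodWord_mid, countAfterHigh,
    wordCount_eq_zero (P := fun w => GoodWord (wcons .high w)) fun _ _ => not_goodWord_high,
    add_zero]

lemma counts_fib (n : ℕ) :
    2 * countAfterHigh n + 1 + Nat.fib n * Nat.fib (n + 1) = Nat.fib (n + 2) ^ 2 ∧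
      countAfterLow n + countAfterBottom n + 1 = Nat.fib (n + 1) * Nat.fib (n + 2) ∧
      countAfterBottom n + Nat.fib n * Nat.fib (n + 1) = countAfterHigh n := by
  induction n with
  | zero =>
    have hL : countAfterLow 0 = 0 :=
      wordCount_eq_zero fun w hw h => not_endsMid_of_padded_zero hw h.1
    have hH : countAfterHigh 0 = 0 :=
      wordCount_eq_zero fun w hw h => not_endsMid_of_padded_zero hw h.1
    have hB : countAfterBottom 0 = 0 :=
      wordCount_eq_zero fun w hw h => not_endsMid_of_padded_zero hw h.1
    simp [hL, hH, hB]
  | succ n ih =>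
    obtain ⟨h1, h2, h3⟩ := ih
    rw [countAfterHigh_succ, countAfterLow_succ, countAfterBottom_succ,
      Nat.fib_add_two (n := n + 1)]
    rw [Nat.fib_add_two (n := n)] at *
    refine ⟨?_, ?_, ?_⟩ <;> nlinarith

lemma countAfterHigh_eq_sum (n : ℕ) :
    countAfterHigh n = ∑ j ∈ Finset.Icc 1 n, fib1 (j - 1) * fib1 j := by
  induction n with
  | zero =>
    have h := (counts_fib 0).1
    simp at h ⊢
    exact h
  | succ n ih =>
    rw [Finset.sum_Icc_succ_top (by omega), ← ih, countAfterHigh_succ]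
    have h := (counts_fib n).2.1
    simp only [fib1, Nat.add_sub_cancel]
    linarith

lemma wordCount_goodWord (n : ℕ) : wordCount (n + 1) GoodWord =
    ∑ i ∈ Finset.Icc 1 n, ∑ j ∈ Finset.Icc 1 i, fib1 (j - 1) * fib1 j := by
  induction n with
  | zero =>
    rw [wordCount_goodWord_succ, countAfterHigh_eq_sum, wordCount_eq_zero]
    · simp
    · rintro w hw ⟨-, -, -, i, -, -, hi, -⟩
      simp [hw i (Nat.zero_le i)] at hi
  | succ n ih =>
    rw [wordCount_goodWord_succ, ih, Finset.sum_Icc_succ_top (by omega), countAfterHigh_eq_sum]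

/-! ### The closed form -/

lemma fib_cassini_mod_two (n : ℕ) :
    Nat.fib (n + 1) * Nat.fib (n + 2) + Nat.fib (n + 1) ^ 2 + n % 2 =
      Nat.fib (n + 2) ^ 2 + (n + 1) % 2 := by
  induction n with
  | zero => simp
  | succ n ih =>
    rw [Nat.fib_add_two (n := n + 1)]
    have : (n + 1 + 1) % 2 = n % 2 := by omega
    rw [this]
    nlinarith

lemma sum_fib1_mul (n : ℕ) :
    (∑ j ∈ Finset.Icc 1 n, fib1 (j - 1) * fib1 j) + (n + 1) % 2 = Nat.fib (n + 1) ^ 2 := by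
  induction n with
  | zero => simp
  | succ n ih =>
    rw [Finset.sum_Icc_succ_top (by omega)]
    have h := fib_cassini_mod_two n
    have : (n + 1 + 1) % 2 = n % 2 := by omega
    simp only [fib1, Nat.add_sub_cancel] at ih ⊢
    rw [this]
    linarith

lemma sum_sum_fib1_mul (n : ℕ) :
    (∑ i ∈ Finset.Icc 1 n, ∑ j ∈ Finset.Icc 1 i, fib1 (j - 1) * fib1 j) + (n + 2) / 2 =
      fib1 n * fib1 (n + 1) := by
  induction n with
  | zero => simp [fib1]
  | succ n ih =>
    rw [Finset.sum_Icc_succ_top (by omega)]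
    have h := sum_fib1_mul (n + 1)
    have : (n + 1 + 2) / 2 = (n + 2) / 2 + (n + 1 + 1) % 2 := by omega
    simp only [fib1] at ih h ⊢
    rw [this, Nat.fib_add_two (n := n + 1)]
    linarith

/-! ### Permutations with one left peak -/

lemma card_filter_ascent_descent_eq_one_iff {N : ℕ} {E : ℕ → Prop} [DecidablePred E]
    (h0 : ¬ E 0) (hN : ∀ i, E i → i ≤ N) :
    ((Finset.Icc 1 N).filter fun i => ¬ E (i - 1) ∧ E i).card = 1 ↔
      ∃ a b, 1 ≤ a ∧ a < b ∧ b ≤ N + 1 ∧ ∀ i, E i ↔ a ≤ i ∧ i < b := by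
  rw [Finset.card_eq_one]
  constructor
  · rintro ⟨p, hp⟩
    have hmem : ∀ i, (1 ≤ i ∧ ¬ E (i - 1) ∧ E i) ↔ i = p := by
      intro i
      rw [← Finset.mem_singleton, ← hp, Finset.mem_filter, Finset.mem_Icc]
      grind
    obtain ⟨hp1, -, hpE⟩ := (hmem p).2 rfl
    have hbelow : ∀ i, i < p → ¬ E i := by
      intro i
      induction i with
      | zero => exact fun _ => h0
      | succ i ih =>
        intro hi hE
        exact hi.ne ((hmem (i + 1)).1 ⟨by omega, ih (by omega), hE⟩)
    have hex : ∃ b, p < b ∧ ¬ E b :=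
      ⟨N + 1, by have := hN p hpE; omega, fun h => by have := hN _ h; omega⟩
    classical
    obtain ⟨hb, hbE⟩ := Nat.find_spec hex
    have habove : ∀ i, Nat.find hex ≤ i → ¬ E i := by
      intro i hi
      induction i, hi using Nat.le_induction with
      | base => exact hbE
      | succ i hi ih =>
        intro hE
        have := (hmem (i + 1)).1 ⟨by omega, ih, hE⟩
        omega
    refine ⟨p, Nat.find hex, hp1, hb, ?_, fun i => ⟨fun hE => ⟨?_, ?_⟩, ?_⟩⟩
    · refine Nat.find_min' hex ⟨by have := hN p hpE; omega, fun h => by have := hN _ h; omega⟩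
    · by_contra h
      exact hbelow i (by omega) hE
    · by_contra h
      exact habove i (by omega) hE
    · rintro ⟨h1, h2⟩
      rcases h1.eq_or_lt with rfl | h1
      · exact hpE
      · by_contra hE
        exact Nat.find_min hex h2 ⟨h1, hE⟩
  · rintro ⟨a, b, ha, hab, hb, hE⟩
    refine ⟨a, ?_⟩
    ext i
    simp only [Finset.mem_filter, Finset.mem_Icc, hE, Finset.mem_singleton]
    omega

lemma pval_succ {n : ℕ} (π : Equiv.Perm (Fin n)) {i : ℕ} (h : i < n) :
    pval π (i + 1) = (π ⟨i, h⟩ : ℕ) + 1 := by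
  simp [pval, h]

lemma lpk_eq_one_iff {n : ℕ} (σ : Equiv.Perm (Fin n)) :
    lpk σ = 1 ↔ ∃ a b : Fin n, a < b ∧ ∀ (k : ℕ) (hk : k + 1 < n),
      σ ⟨k + 1, hk⟩ < σ ⟨k, by omega⟩ ↔ (a : ℕ) ≤ k ∧ k < b := by
  classical
  let E : ℕ → Prop := fun i => 1 ≤ i ∧ i ≤ n - 1 ∧ pval σ (i + 1) < pval σ i
  have hE0 : ¬ E 0 := fun h => by simpa using h.1
  have hEsucc : ∀ (k : ℕ) (hk : k + 1 < n),
      E (k + 1) ↔ σ ⟨k + 1, hk⟩ < σ ⟨k, by omega⟩ := by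
    intro k hk
    simp only [E, pval_succ σ hk, pval_succ σ (show k < n by omega), Fin.lt_def]
    omega
  have hlpk : lpk σ = ((Finset.Icc 1 (n - 1)).filter fun i => ¬ E (i - 1) ∧ E i).card := by
    refine congrArg Finset.card (Finset.filter_congr fun i hi => ?_)
    obtain ⟨h1, h2⟩ := Finset.mem_Icc.1 hi
    rcases i with _ | _ | k
    · omega
    · simp only [E, pval_succ σ (show 0 < n by omega)]
      simp [pval]
      omega
    · have hne : σ ⟨k + 1, by omega⟩ ≠ σ ⟨k, by omega⟩ := by simp
      have hne' := Fin.val_ne_of_ne hne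
      simp only [Nat.add_sub_cancel, hEsucc k (by omega), E,
        pval_succ σ (show k + 1 < n by omega), pval_succ σ (show k < n by omega), Fin.lt_def]
      omega
  rw [hlpk, card_filter_ascent_descent_eq_one_iff hE0 fun i h => h.2.1]
  constructor
  · rintro ⟨a, b, ha, hab, hb, h⟩
    refine ⟨⟨a - 1, by omega⟩, ⟨b - 1, by omega⟩, ?_, fun k hk => ?_⟩
    · simp only [Fin.lt_def]; omega
    · rw [← hEsucc k hk, h]
      simp only
      omega
  · rintro ⟨a, b, hab, h⟩
    rw [Fin.lt_def] at hab
    refine ⟨a + 1, b + 1, by omega, by omega, by omega, fun i => ?_⟩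
    rcases i with _ | k
    · simp [hE0]
    · by_cases hk : k + 1 < n
      · rw [hEsucc k hk, h]
        omega
      · have : ¬ E (k + 1) := fun h => by have := h.2.1; omega
        simp only [this, false_iff]
        omega

lemma avoids321_iff {n : ℕ} (π : Equiv.Perm (Fin n)) :
    Avoids321 π ↔ ∀ (i : ℕ) (h : i + 2 < n),
      ¬ (π ⟨i + 1, by omega⟩ < π ⟨i, by omega⟩ ∧ π ⟨i + 2, h⟩ < π ⟨i + 1, by omega⟩) := by
  constructor
  · intro H i h
    have := H (i + 1) (by omega) (by omega)
    rwa [pval_succ π (show i < n by omega), pval_succ π (show i + 1 < n by omega),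
      pval_succ π (show i + 2 < n by omega), Nat.add_lt_add_iff_right,
      Nat.add_lt_add_iff_right] at this
  · intro H i h1 h2
    obtain ⟨i, rfl⟩ : ∃ k, i = k + 1 := ⟨i - 1, by omega⟩
    have := H i (by omega)
    rwa [pval_succ π (show i < n by omega), pval_succ π (show i + 1 < n by omega),
      pval_succ π (show i + 2 < n by omega), Nat.add_lt_add_iff_right,
      Nat.add_lt_add_iff_right]

/-! ### Words encode permutations -/

/-- The key of position `i`: comparing keys compares the values of the encoded permutation. -/
def wkey (n : ℕ) (w : ℕ → Letter) (i : ℕ) : ℕ :=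
  match w i with
  | .low => i
  | .mid => 2 * n - i
  | .high => 2 * n + 1 + i

/-- The word `w` encodes `π` if the values of `π` are ordered as the keys of `w`. -/
def Encodes {n : ℕ} (w : ℕ → Letter) (π : Equiv.Perm (Fin n)) : Prop :=
  ∀ i j : Fin n, π i < π j ↔ wkey n w i < wkey n w j

lemma wkey_injective (n : ℕ) (w : ℕ → Letter) :
    Function.Injective fun i : Fin n => wkey n w i := by
  intro i j h
  have hi := i.2
  have hj := j.2
  apply Fin.ext
  simp only [wkey] at h
  cases hwi : w i <;> cases hwj : w j <;> simp only [hwi, hwj] at h <;> omega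

lemma exists_encodes (n : ℕ) (w : ℕ → Letter) : ∃ π : Equiv.Perm (Fin n), Encodes w π := by
  let f : Fin n → ℕ := fun i => wkey n w i
  have hmono : StrictMono (f ∘ Tuple.sort f) :=
    (Tuple.monotone_sort f).strictMono_of_injective
      ((wkey_injective n w).comp (Tuple.sort f).injective)
  refine ⟨(Tuple.sort f).symm, fun i j => ?_⟩
  rw [← hmono.lt_iff_lt]
  simp [f]

lemma Encodes.unique {n : ℕ} {w : ℕ → Letter} {π ρ : Equiv.Perm (Fin n)}
    (hπ : Encodes w π) (hρ : Encodes w ρ) : π = ρ := by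
  have hmono : StrictMono (π ∘ ρ.symm) := fun x y hxy => by
    have := (hπ (ρ.symm x) (ρ.symm y)).2 ((hρ _ _).1 (by simpa using hxy))
    simpa using this
  have hid := hmono.range_inj (g := id) strictMono_id |>.1
    (by rw [(π.surjective.comp ρ.symm.surjective).range_eq, Set.range_id])
  ext i
  have := congrFun hid (ρ i)
  simpa using congrArg Fin.val this

lemma Encodes.avoids321_iff {n : ℕ} {w : ℕ → Letter} {π : Equiv.Perm (Fin n)}
    (he : Encodes w π) (hw : Padded n w) : Avoids321 π ↔ NoDoubleDescent w := by
  have hkey : ∀ i, i + 2 < n →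
      (¬ (wkey n w (i + 1) < wkey n w i ∧ wkey n w (i + 2) < wkey n w (i + 1)) ↔
        (w i ≠ .low → w (i + 1) = .mid → w (i + 2) = .high)) := by
    intro i hi
    simp only [wkey]
    cases w i <;> cases w (i + 1) <;> cases w (i + 2) <;> simp <;> omega
  rw [_root_.avoids321_iff]
  constructor
  · intro H i
    by_cases hi : i + 2 < n
    · rw [← hkey i hi]
      have := H i hi
      rwa [he, he] at this
    · exact fun _ _ => hw _ (by omega)
  · intro H i hi
    rw [he, he]
    exact (hkey i hi).2 (H i)

lemma GoodWord.exists_descent_interval {n : ℕ} {w : ℕ → Letter} {π : Equiv.Perm (Fin n)}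
    (hg : GoodWord w) (hw : Padded n w) (he : Encodes w π) :
    ∃ a b : Fin n, a < b ∧ (∀ i, π i < a ↔ w i = .low) ∧ (∀ i, b < π i ↔ w i = .high) ∧
      ∀ (k : ℕ) (hk : k + 1 < n),
        π⁻¹ ⟨k + 1, hk⟩ < π⁻¹ ⟨k, by omega⟩ ↔ (a : ℕ) ≤ k ∧ k < b := by
  have hmidlt : ∀ i, w i = .mid → i < n := fun i hi => by
    by_contra h
    simp [hw i (by omega)] at hi
  obtain ⟨i₀, j₀, hij, hi₀, hj₀⟩ := hg.twoMids
  let s : Finset (Fin n) := Finset.univ.filter fun i : Fin n => w i = .mid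
  have hs : s.Nonempty := ⟨⟨i₀, hmidlt i₀ hi₀⟩, by simp [s, hi₀]⟩
  obtain ⟨x, hx, hxmin⟩ := s.exists_min_image id hs
  obtain ⟨y, hy, hymax⟩ := s.exists_max_image id hs
  replace hx : w x = .mid := by simpa [s] using hx
  replace hy : w y = .mid := by simpa [s] using hy
  replace hxmin : ∀ i, w i = .mid → x.1 ≤ i := fun i hi =>
    hxmin ⟨i, hmidlt i hi⟩ (by simp [s, hi])
  replace hymax : ∀ i, w i = .mid → i ≤ y.1 := fun i hi =>
    hymax ⟨i, hmidlt i hi⟩ (by simp [s, hi])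
  have hxy : x.1 < y.1 := (hxmin i₀ hi₀).trans_lt (hij.trans_le (hymax j₀ hj₀))
  have hlow : ∀ i, π i < π y ↔ w i = .low := by
    intro i
    rw [he]
    have := hymax i
    have := i.2
    have := y.2
    cases hi : w i <;> simp only [wkey, hi, hy] <;> grind
  have hhigh : ∀ i, π x < π i ↔ w i = .high := by
    intro i
    rw [he]
    have := hxmin i
    have := i.2
    have := x.2
    cases hi : w i <;> simp only [wkey, hi, hx] <;> grind
  have hyx : π y < π x := by
    rw [he]
    have := y.2
    simp only [wkey, hx, hy]
    omega
  refine ⟨π y, π x, hyx, hlow, hhigh, fun k hk => ?_⟩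
  obtain ⟨u, hu⟩ := π.surjective ⟨k, by omega⟩
  obtain ⟨v, hv⟩ := π.surjective ⟨k + 1, hk⟩
  have huv : wkey n w u < wkey n w v := by
    rw [← he, hu, hv]
    simp [Fin.lt_def]
  have hu' : π⁻¹ ⟨k, by omega⟩ = u := by rw [← hu]; simp
  have hv' : π⁻¹ ⟨k + 1, hk⟩ = v := by rw [← hv]; simp
  rw [hu', hv']
  have hlu := hlow u
  have hlv := hlow v
  have hhu := hhigh u
  have hhv := hhigh v
  rw [hu, Fin.lt_def] at hlu hhu
  rw [hv, Fin.lt_def] at hlv hhv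
  rw [Fin.lt_def] at hyx ⊢
  simp only at hlu hlv hhu hhv
  have hun := u.2
  have hvn := v.2
  cases hwu : w u <;> cases hwv : w v <;> simp only [hwu, hwv, wkey, reduceCtorEq, iff_true,
    iff_false] at hlu hlv hhu hhv huv
  · omega
  · have hvy : v = y := π.injective (Fin.ext (by rw [hv]; simp only; omega))
    obtain ⟨j, hj, hm⟩ := hg.lowBeforeMid u hwu
    have := hymax j hm
    subst hvy
    omega
  · omega
  · omega
  · omega
  · have hux : u = x := π.injective (Fin.ext (by rw [hu]; simp only; omega))
    obtain ⟨j, hj, hm⟩ := hg.midBeforeHigh v hwv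
    have := hxmin j hm
    subst hux
    omega
  · omega
  · omega
  · omega

/-- The word recording, at each position, whether the value of `π` lies below `a`, in `[a, b]`,
or above `b`. -/
def wordOf {n : ℕ} (π : Equiv.Perm (Fin n)) (a b : Fin n) (i : ℕ) : Letter :=
  if h : i < n then
    if π ⟨i, h⟩ < a then .low else if π ⟨i, h⟩ ≤ b then .mid else .high
  else .high

lemma padded_wordOf {n : ℕ} (π : Equiv.Perm (Fin n)) (a b : Fin n) :
    Padded n (wordOf π a b) := fun i hi => by simp [wordOf, hi]

lemma fin_lt_of_forall_succ {n : ℕ} {f : Fin n → ℕ} {c d : ℕ}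
    (h : ∀ (k : ℕ) (hk : k + 1 < n), c ≤ k → k < d → f ⟨k, by omega⟩ < f ⟨k + 1, hk⟩)
    {i j : Fin n} (hi : c ≤ i) (hij : i < j) (hj : j ≤ d) : f i < f j := by
  obtain ⟨i, hin⟩ := i
  obtain ⟨j, hjn⟩ := j
  simp only [Fin.mk_lt_mk] at hi hij hj
  induction j, hij using Nat.le_induction with
  | base => exact h i hjn hi (by omega)
  | succ j hij ih =>
    exact (ih (by omega) (by omega)).trans (h j hjn (by omega) (by omega))

lemma exists_goodWord_encodes {n : ℕ} {π : Equiv.Perm (Fin n)} (hπ : Avoids321 π)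
    (hlpk : ilpk π = 1) : ∃ w, Padded n w ∧ GoodWord w ∧ Encodes w π := by
  obtain ⟨a, b, hab, hdes⟩ := (lpk_eq_one_iff π⁻¹).1 hlpk
  have hne : ∀ (k : ℕ) (hk : k + 1 < n),
      (π⁻¹ ⟨k + 1, hk⟩ : ℕ) ≠ (π⁻¹ ⟨k, by omega⟩ : ℕ) := fun k hk h => by
    simpa using π⁻¹.injective (Fin.ext h)
  have hincr : ∀ {c d : ℕ}, (d ≤ a ∨ b ≤ c) → ∀ {i j : Fin n}, c ≤ i → i < j → j ≤ d →
      (π⁻¹ i : ℕ) < π⁻¹ j := by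
    intro c d hcd i j
    refine fin_lt_of_forall_succ (f := fun i => (π⁻¹ i : ℕ)) fun k hk h1 h2 => ?_
    have := hdes k hk
    have := hne k hk
    rw [Fin.lt_def] at *
    omega
  have hdecr : ∀ {i j : Fin n}, a ≤ i → i < j → j ≤ b → π⁻¹ j < π⁻¹ i := by
    intro i j hi hij hj
    have := fin_lt_of_forall_succ (f := fun i => n - (π⁻¹ i : ℕ)) (c := a) (d := b)
      (fun k hk h1 h2 => by
        have := (hdes k hk).2 ⟨h1, h2⟩
        have := (π⁻¹ ⟨k, by omega⟩).2
        rw [Fin.lt_def] at *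
        omega) hi hij hj
    rw [Fin.lt_def]
    omega
  have hw : ∀ i : Fin n, wordOf π a b i =
      if π i < a then .low else if π i ≤ b then .mid else .high := fun i => by simp [wordOf]
  have he : Encodes (wordOf π a b) π := by
    have hforward : ∀ i j : Fin n, π i < π j →
        wkey n (wordOf π a b) i < wkey n (wordOf π a b) j := by
      intro i j hij
      have hinv : ∀ i, π⁻¹ (π i) = i := π.symm_apply_apply
      have hi := i.2
      have hj := j.2
      have hI := @hincr 0 a (Or.inl le_rfl) (π i) (π j)
      have hJ := @hincr b n (Or.inr le_rfl) (π i) (π j)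
      have hD := @hdecr (π i) (π j)
      simp only [hinv, Fin.lt_def, Fin.le_def] at hI hJ hD hij hab
      simp only [wkey, hw, Fin.lt_def, Fin.le_def]
      split_ifs <;> simp only <;> omega
    intro i j
    refine ⟨hforward i j, fun h => ?_⟩
    by_contra hn
    rcases (not_lt.1 hn).eq_or_lt with h' | h'
    · rw [π.injective h'] at h
      exact lt_irrefl _ h
    · exact lt_asymm h (hforward j i h')
  have hmida : wordOf π a b (π⁻¹ a : Fin n) = .mid := by
    rw [hw]
    simp [hab.le]
  have hmidb : wordOf π a b (π⁻¹ b : Fin n) = .mid := by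
    rw [hw]
    simp [hab.le]
  refine ⟨wordOf π a b, padded_wordOf π a b, ⟨?_, ?_, ?_, ?_⟩, he⟩
  · exact (he.avoids321_iff (padded_wordOf π a b)).1 hπ
  · intro i hi
    have hin : i < n := by
      by_contra h
      simp [wordOf, h] at hi
    refine ⟨_, ?_, hmida⟩
    have hia : π ⟨i, hin⟩ < a := by
      have := hw ⟨i, hin⟩
      simp only [hi] at this
      by_contra h
      rw [if_neg h] at this
      split_ifs at this
    simpa using hincr (c := 0) (d := a) (Or.inl le_rfl) (Nat.zero_le _) hia le_rfl
  · intro j hj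
    refine ⟨_, ?_, hmidb⟩
    by_cases hjn : j < n
    · have hjb : b < π ⟨j, hjn⟩ := by
        have := hw ⟨j, hjn⟩
        simp only [hj] at this
        by_contra h
        rw [if_pos (not_lt.1 h)] at this
        split_ifs at this
      simpa using hincr (c := b) (d := n) (Or.inr le_rfl) le_rfl hjb (Fin.is_lt _).le
    · exact (Fin.is_lt _).trans_le (not_lt.1 hjn)
  · exact ⟨_, _, hdecr le_rfl hab le_rfl, hmidb, hmida⟩

lemma GoodWord.eq_of_encodes {n : ℕ} {w w' : ℕ → Letter} {π : Equiv.Perm (Fin n)}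
    (hg : GoodWord w) (hg' : GoodWord w') (hw : Padded n w) (hw' : Padded n w')
    (he : Encodes w π) (he' : Encodes w' π) : w = w' := by
  obtain ⟨a, b, hab, hlow, hhigh, hdes⟩ := hg.exists_descent_interval hw he
  obtain ⟨a', b', hab', hlow', hhigh', hdes'⟩ := hg'.exists_descent_interval hw' he'
  rw [Fin.lt_def] at hab hab'
  have hiff : ∀ k, k + 1 < n → (((a : ℕ) ≤ k ∧ k < b) ↔ ((a' : ℕ) ≤ k ∧ k < b')) :=
    fun k hk => (hdes k hk).symm.trans (hdes' k hk)
  have h1 := hiff a (by omega)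
  have h2 := hiff a' (by omega)
  have h3 := hiff (b - 1) (by omega)
  have h4 := hiff (b' - 1) (by omega)
  obtain rfl : a = a' := Fin.ext (by omega)
  obtain rfl : b = b' := Fin.ext (by omega)
  funext i
  by_cases hi : i < n
  · have hl := (hlow ⟨i, hi⟩).symm.trans (hlow' ⟨i, hi⟩)
    have hh := (hhigh ⟨i, hi⟩).symm.trans (hhigh' ⟨i, hi⟩)
    simp only at hl hh
    cases h : w i <;> cases h' : w' i <;> simp [h, h'] at hl hh ⊢
  · rw [hw i (by omega), hw' i (by omega)]

lemma card_avoids321_ilpk_one (n : ℕ) :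
    Nat.card {π : Equiv.Perm (Fin n) // Avoids321 π ∧ ilpk π = 1} = wordCount n GoodWord := by
  choose P hP using exists_encodes n
  refine (Nat.card_eq_of_bijective
    (fun w : {w : ℕ → Letter // Padded n w ∧ GoodWord w} =>
      (⟨P w.1, ((hP w.1).avoids321_iff w.2.1).2 w.2.2.noDoubleDescent, ?_⟩ :
        {π : Equiv.Perm (Fin n) // Avoids321 π ∧ ilpk π = 1})) ⟨?_, ?_⟩).symm
  · obtain ⟨a, b, hab, -, -, h⟩ := w.2.2.exists_descent_interval w.2.1 (hP w.1)
    exact (lpk_eq_one_iff _).2 ⟨a, b, hab, h⟩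
  · intro w w' h
    have h' : P w.1 = P w'.1 := congrArg Subtype.val h
    exact Subtype.ext (w.2.2.eq_of_encodes w'.2.2 w.2.1 w'.2.1 (h' ▸ hP w.1) (hP w'.1))
  · rintro ⟨π, hπ, hlpk⟩
    obtain ⟨w, hw, hg, he⟩ := exists_goodWord_encodes hπ hlpk
    exact ⟨⟨w, hw, hg⟩, Subtype.ext ((hP w).unique he)⟩

/-- For `n ≥ 1`, the number of permutations in `S_n` avoiding `321`
as a consecutive pattern with `ilpk(π) = 1` equals
`Σ_{i=1}^{n-1} Σ_{j=1}^{i} f_{j-1} f_j = f_{n-1} f_n − ⌊(n+1)/2⌋`. -/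
theorem count_avoids321_ilpk_one {n : ℕ} (hn : 1 ≤ n) :
    Nat.card { π : Equiv.Perm (Fin n) // Avoids321 π ∧ ilpk π = 1 } =
        (∑ i ∈ Finset.Icc 1 (n - 1), ∑ j ∈ Finset.Icc 1 i, fib1 (j - 1) * fib1 j) ∧
      (∑ i ∈ Finset.Icc 1 (n - 1), ∑ j ∈ Finset.Icc 1 i, fib1 (j - 1) * fib1 j) =
        fib1 (n - 1) * fib1 n - (n + 1) / 2 := by
  obtain ⟨m, rfl⟩ : ∃ k, n = k + 1 := ⟨n - 1, by omega⟩
  refine ⟨by rw [card_avoids321_ilpk_one, wordCount_goodWord, Nat.add_sub_cancel], ?_⟩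
  have h := sum_sum_fib1_mul m
  rw [Nat.add_sub_cancel]
  omega
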